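/- Let n ≥ 1, let c ≥ 0 be a real number, and let f, v : ℝⁿ → ℝ be C² functions which are ℤⁿ-periodic (f(x+m) = f(x) and v(x+m) = v(x) for all x ∈ ℝⁿ, m ∈ ℤⁿ). Suppose that f ≥ 0 everywhere, that −Σᵢ₌₁ⁿ ∂²f/∂xᵢ²(x) ≤ c·f(x) for all x, and that v(x) − Σᵢ₌₁ⁿ ∂²v/∂xᵢ²(x) = f(x) for all x. Then v(x) ≥ f(x)/(1 + c) for all x ∈ ℝⁿ. -/

import Mathlib

/-- The second derivative of a real function at a local minimum is nonnegative. -/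
theorem IsLocalMin.deriv_deriv_nonneg {φ : ℝ → ℝ} {a : ℝ} (h : IsLocalMin φ a)
    (hc : ContinuousAt φ a) : 0 ≤ deriv (deriv φ) a := by
  by_contra! hneg
  have hmax := isLocalMax_of_deriv_deriv_neg hneg h.deriv_eq_zero hc
  have heq : φ =ᶠ[nhds a] fun _ => φ a := by
    filter_upwards [h, hmax] with x h₁ h₂ using le_antisymm h₂ h₁
  have hzero : deriv (deriv φ) a = 0 := by
    rw [heq.deriv.deriv_eq]
    simp
  exact hneg.ne hzero

/-- Second directional derivatives at a local minimum are nonnegative. -/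
theorem IsLocalMin.fderiv_fderiv_nonneg {E : Type*} [NormedAddCommGroup E] [NormedSpace ℝ E]
    {g : E → ℝ} {p : E} (h : IsLocalMin g p) (hg : ContDiff ℝ 2 g) (e : E) :
    0 ≤ fderiv ℝ (fun y => fderiv ℝ g y e) p e := by
  have hline : ∀ t : ℝ, HasDerivAt (fun t : ℝ => p + t • e) e t := fun t => by
    simpa using ((hasDerivAt_id t).smul_const e).const_add p
  have hdg : Differentiable ℝ g := hg.differentiable (by norm_num)
  have hdg' : Differentiable ℝ fun y => fderiv ℝ g y e :=
    ((hg.fderiv_right (m := 1) (by norm_num)).clm_apply contDiff_const).differentiable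
      (by norm_num)
  have hderiv : deriv (fun t : ℝ => g (p + t • e)) = fun t => fderiv ℝ g (p + t • e) e := by
    funext t
    exact ((hdg _).hasFDerivAt.comp_hasDerivAt t (hline t)).deriv
  have hderiv₂ : deriv (deriv fun t : ℝ => g (p + t • e)) 0
      = fderiv ℝ (fun y => fderiv ℝ g y e) p e := by
    rw [hderiv]
    simpa [Function.comp_def] using
      ((hdg' _).hasFDerivAt.comp_hasDerivAt (0 : ℝ) (hline 0)).deriv
  have hcont : ContinuousAt (fun t : ℝ => p + t • e) 0 := (hline 0).continuousAt
  have hmin : IsLocalMin (fun t : ℝ => g (p + t • e)) 0 := by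
    have ht : Filter.Tendsto (fun t : ℝ => p + t • e) (nhds 0) (nhds p) := by
      simpa [ContinuousAt] using hcont
    filter_upwards [ht.eventually h] with t hle
    simpa using hle
  rw [← hderiv₂]
  exact hmin.deriv_deriv_nonneg (hdg.continuous.continuousAt.comp hcont)

/-- A continuous function on `ℝⁿ` that is periodic under integer translations attains its
minimum. -/
theorem exists_forall_le_of_int_periodic {ι : Type*} {w : (ι → ℝ) → ℝ}
    (hw : Continuous w)
    (hper : ∀ (x : ι → ℝ) (m : ι → ℤ), w (x + fun i => (m i : ℝ)) = w x) :
    ∃ p, ∀ x, w p ≤ w x := by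
  have hcompact : IsCompact (Set.univ.pi fun _ : ι => Set.Icc (0 : ℝ) 1) :=
    isCompact_univ_pi fun _ => isCompact_Icc
  obtain ⟨p, -, hp⟩ := hcompact.exists_isMinOn ⟨0, fun _ _ => by simp⟩ hw.continuousOn
  refine ⟨p, fun x => ?_⟩
  have hx : w (fun i => Int.fract (x i)) = w x := by
    rw [← hper _ fun i => ⌊x i⌋]
    congr 1
    funext i
    exact Int.fract_add_floor (x i)
  rw [← hx]
  exact hp fun i _ => ⟨Int.fract_nonneg _, (Int.fract_lt_one _).le⟩

/-- Second directional derivatives are linear. -/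
theorem fderiv_fderiv_sub_const_mul {E : Type*} [NormedAddCommGroup E] [NormedSpace ℝ E]
    {f v : E → ℝ} (hf : ContDiff ℝ 2 f) (hv : ContDiff ℝ 2 v) (k : ℝ) (x e : E) :
    fderiv ℝ (fun y => fderiv ℝ (fun z => v z - k * f z) y e) x e
      = fderiv ℝ (fun y => fderiv ℝ v y e) x e
        - k * fderiv ℝ (fun y => fderiv ℝ f y e) x e := by
  have hd {g : E → ℝ} (hg : ContDiff ℝ 2 g) : Differentiable ℝ g :=
    hg.differentiable (by norm_num)
  have hd' {g : E → ℝ} (hg : ContDiff ℝ 2 g) : Differentiable ℝ fun y => fderiv ℝ g y e :=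
    ((hg.fderiv_right (m := 1) (by norm_num)).clm_apply contDiff_const).differentiable
      (by norm_num)
  have hsub {a b : E → ℝ} (ha : Differentiable ℝ a) (hb : Differentiable ℝ b) (y : E) :
      fderiv ℝ (fun z => a z - k * b z) y e = fderiv ℝ a y e - k * fderiv ℝ b y e := by
    rw [fderiv_fun_sub (ha y) ((hb y).const_mul k), fderiv_const_mul (hb y)]
    simp
  simp_rw [hsub (hd hv) (hd hf)]
  exact hsub (hd' hv) (hd' hf) x

/-- Let n ≥ 1, c ≥ 0, and let f, v : ℝⁿ → ℝ be C² and ℤⁿ-periodic.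
If f ≥ 0 everywhere, −Σᵢ ∂²f/∂xᵢ² ≤ c·f pointwise, and v − Σᵢ ∂²v/∂xᵢ² = f pointwise,
then v(x) ≥ f(x)/(1 + c) for all x. -/
theorem stmt6 (n : ℕ) (hn : 1 ≤ n) (c : ℝ) (hc : 0 ≤ c)
    (f v : (Fin n → ℝ) → ℝ)
    (hf : ContDiff ℝ 2 f) (hv : ContDiff ℝ 2 v)
    (hfper : ∀ (x : Fin n → ℝ) (m : Fin n → ℤ), f (x + fun i => (m i : ℝ)) = f x)
    (hvper : ∀ (x : Fin n → ℝ) (m : Fin n → ℤ), v (x + fun i => (m i : ℝ)) = v x)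
    (hfpos : ∀ x : Fin n → ℝ, 0 ≤ f x)
    (hflap : ∀ x : Fin n → ℝ,
      -(∑ i : Fin n,
          fderiv ℝ (fun y => fderiv ℝ f y (Pi.single i 1)) x (Pi.single i 1)) ≤ c * f x)
    (hveq : ∀ x : Fin n → ℝ,
      v x - ∑ i : Fin n,
        fderiv ℝ (fun y => fderiv ℝ v y (Pi.single i 1)) x (Pi.single i 1) = f x) :
    ∀ x : Fin n → ℝ, f x / (1 + c) ≤ v x := by
  have hc' : 0 < 1 + c := by linarith
  obtain ⟨p, hp⟩ := exists_forall_le_of_int_periodic (w := fun z => v z - (1 + c)⁻¹ * f z)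
    (hv.continuous.sub (continuous_const.mul hf.continuous))
    (fun x m => by simp only [hfper, hvper])
  have hlap : 0 ≤ ∑ i : Fin n, (fderiv ℝ (fun y => fderiv ℝ v y (Pi.single i 1)) p (Pi.single i 1)
      - (1 + c)⁻¹ * fderiv ℝ (fun y => fderiv ℝ f y (Pi.single i 1)) p (Pi.single i 1)) := by
    refine Finset.sum_nonneg fun i _ => ?_
    rw [← fderiv_fderiv_sub_const_mul hf hv]
    exact IsLocalMin.fderiv_fderiv_nonneg (Filter.Eventually.of_forall hp)
      (hv.sub (contDiff_const.mul hf)) _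
  rw [Finset.sum_sub_distrib, ← Finset.mul_sum] at hlap
  have hmul := mul_le_mul_of_nonneg_left (hflap p) (inv_pos.2 hc').le
  have hfp : (1 + c)⁻¹ * (c * f p) = f p - (1 + c)⁻¹ * f p := by
    field_simp
    ring
  intro x
  have hpx := hp x
  rw [div_eq_inv_mul]
  linarith [hveq p]
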